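/- Suppose χ is a primitive Dirichlet character modulo N_β, and let c be a positive integer with gcd(c, g) = 1, where g = gcd(N_β, N_β(γ,β)). Then G_{γ,n}(c; β, χ) = χ(c) · χ̄(−N_β(γ,β)) · G(χ) · c^m · ∑_{a | c} μ(c/a) · a^{1−m} · N_{γ,n}(a), where μ is the Möbius function, χ̄ is the complex conjugate character, and the sum runs over positive divisors a of c. -/

import Mathlib

open Finset Matrix

namespace EisensteinWeil

variable {m : ℕ}

/-- The bilinear form `(x,y) = xᵀ S y` on `ℚ^m`. -/
def bil (S : Matrix (Fin m) (Fin m) ℤ) (x y : Fin m → ℚ) : ℚ :=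
  x ⬝ᵥ (S.map (Int.cast : ℤ → ℚ)).mulVec y

/-- The quadratic form `Q(x) = (x,x)/2`. -/
def Qf (S : Matrix (Fin m) (Fin m) ℤ) (x : Fin m → ℚ) : ℚ := bil S x x / 2

/-- Membership in the dual lattice `L' = S⁻¹ℤ^m`: `x ∈ L'` iff `(x,r) ∈ ℤ` for all `r ∈ ℤ^m`. -/
def memDual (S : Matrix (Fin m) (Fin m) ℤ) (γ : Fin m → ℚ) : Prop :=
  ∀ r : Fin m → ℤ, ∃ z : ℤ, bil S γ (fun i => (r i : ℚ)) = z

/-- `N` is the order of `γ + ℤ^m` in `L'/ℤ^m`, i.e. the smallest positive integer with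
`N • γ ∈ ℤ^m`. -/
def isOrderOf (γ : Fin m → ℚ) (N : ℕ) : Prop :=
  0 < N ∧ (∀ i, ∃ z : ℤ, (N : ℚ) * γ i = z) ∧
    ∀ k : ℕ, 0 < k → (∀ i, ∃ z : ℤ, (k : ℚ) * γ i = z) → N ≤ k

/-- The representation number `N_{γ,n}(a)`, counting `r ∈ (ℤ^m)/(aℤ^m)`
(represented by `r : Fin m → Fin a`) with `Q(r − γ) + n ≡ 0 (mod a)`. -/
noncomputable def repNum (S : Matrix (Fin m) (Fin m) ℤ) (γ : Fin m → ℚ) (n : ℚ) (a : ℕ) : ℕ :=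
  Nat.card {r : Fin m → Fin a //
    ∃ t : ℤ, Qf S ((fun i => ((r i : ℕ) : ℚ)) - γ) + n = (a : ℚ) * t}

/-- `e(x) = e^{2πix}`. -/
noncomputable def eQ (x : ℚ) : ℂ := Complex.exp (2 * Real.pi * Complex.I * (x : ℂ))

/-- A canonical choice of inverse of `d` modulo `c`. -/
def adInv (c d : ℕ) : ℕ := ((d : ZMod c)⁻¹).val

/-- The sum `G_{γ,n}(c; β, χ)`. -/
noncomputable def Gsum (S : Matrix (Fin m) (Fin m) ℤ) (γ : Fin m → ℚ) (n : ℚ)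
    (β : Fin m → ℚ) (Nβ : ℕ) (χ : DirichletCharacter ℂ Nβ) (c : ℕ) : ℂ :=
  ∑ ν ∈ (range Nβ).filter (fun ν => Nat.Coprime ν Nβ), χ (ν : ZMod Nβ) *
    ∑ d ∈ (range c).filter (fun d => Nat.Coprime d c),
      ∑ r ∈ Fintype.piFinset (fun _ : Fin m => range c),
        eQ (((adInv c d : ℚ) * Qf S (ν • β + fun i => (r i : ℚ))
            - bil S γ (ν • β + fun i => (r i : ℚ))
            + (d : ℚ) * (Qf S γ + n)) / c)

/-- The Gauss sum `G(χ) = ∑_{u mod N, gcd(u,N)=1} χ(u) e(u/N)`. -/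
noncomputable def gaussS (N : ℕ) (χ : DirichletCharacter ℂ N) : ℂ :=
  ∑ u ∈ (range N).filter (fun u => Nat.Coprime u N), χ (u : ZMod N) * eQ (u / N)


lemma bil_add_left (S : Matrix (Fin m) (Fin m) ℤ) (x y z : Fin m → ℚ) :
    bil S (x + y) z = bil S x z + bil S y z := by
  simp [bil, add_dotProduct]

lemma bil_add_right (S : Matrix (Fin m) (Fin m) ℤ) (x y z : Fin m → ℚ) :
    bil S x (y + z) = bil S x y + bil S x z := by
  simp [bil, Matrix.mulVec_add, dotProduct_add]

lemma bil_smul_left (S : Matrix (Fin m) (Fin m) ℤ) (q : ℚ) (x y : Fin m → ℚ) :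
    bil S (q • x) y = q * bil S x y := by
  simp [bil, smul_dotProduct]

lemma bil_smul_right (S : Matrix (Fin m) (Fin m) ℤ) (q : ℚ) (x y : Fin m → ℚ) :
    bil S x (q • y) = q * bil S x y := by
  simp [bil, Matrix.mulVec_smul, dotProduct_smul]

lemma bil_comm {S : Matrix (Fin m) (Fin m) ℤ} (hS : S.IsSymm) (x y : Fin m → ℚ) :
    bil S x y = bil S y x := by
  have hS' : (S.map (Int.cast : ℤ → ℚ))ᵀ = S.map (Int.cast : ℤ → ℚ) := by
    rw [← Matrix.transpose_map, hS.eq]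
  rw [bil, bil, dotProduct_comm, ← Matrix.vecMul_transpose, hS', ← Matrix.dotProduct_mulVec]

lemma Qf_add {S : Matrix (Fin m) (Fin m) ℤ} (hS : S.IsSymm) (x y : Fin m → ℚ) :
    Qf S (x + y) = Qf S x + bil S x y + Qf S y := by
  simp only [Qf, bil_add_left, bil_add_right, bil_comm hS y x]
  ring

lemma Qf_smul (S : Matrix (Fin m) (Fin m) ℤ) (q : ℚ) (x : Fin m → ℚ) :
    Qf S (q • x) = q ^ 2 * Qf S x := by
  simp only [Qf, bil_smul_left, bil_smul_right]
  ring

/-- The inclusion `ℤ^m → ℚ^m`. -/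
def latticeVec (r : Fin m → ℤ) : Fin m → ℚ := fun i => (r i : ℚ)

lemma latticeVec_add (r s : Fin m → ℤ) :
    latticeVec (r + s) = latticeVec r + latticeVec s := by
  ext i; simp [latticeVec]

lemma latticeVec_smul (k : ℤ) (r : Fin m → ℤ) :
    latticeVec (k • r) = (k : ℚ) • latticeVec r := by
  ext i; simp [latticeVec]

lemma latticeVec_natCast (r : Fin m → ℕ) :
    latticeVec (fun i => (r i : ℤ)) = fun i => (r i : ℚ) :=
  funext fun i => Int.cast_natCast (r i)

lemma exists_bil_latticeVec {S : Matrix (Fin m) (Fin m) ℤ} {γ : Fin m → ℚ} (hγ : memDual S γ)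
    (r : Fin m → ℤ) : ∃ z : ℤ, bil S γ (latticeVec r) = z := hγ r

lemma memDual_latticeVec (S : Matrix (Fin m) (Fin m) ℤ) (r : Fin m → ℤ) :
    memDual S (latticeVec r) := by
  intro s
  refine ⟨r ⬝ᵥ S.mulVec s, ?_⟩
  simp [bil, latticeVec, dotProduct, Matrix.mulVec]

lemma memDual_add {S : Matrix (Fin m) (Fin m) ℤ} {x y : Fin m → ℚ} (hx : memDual S x)
    (hy : memDual S y) : memDual S (x + y) := by
  intro s
  obtain ⟨u, hu⟩ := hx s
  obtain ⟨v, hv⟩ := hy s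
  exact ⟨u + v, by rw [bil_add_left, hu, hv]; push_cast; ring⟩

lemma memDual_smul {S : Matrix (Fin m) (Fin m) ℤ} {x : Fin m → ℚ} (k : ℤ) (hx : memDual S x) :
    memDual S ((k : ℚ) • x) := by
  intro s
  obtain ⟨u, hu⟩ := hx s
  exact ⟨k * u, by rw [bil_smul_left, hu]; push_cast; ring⟩

lemma two_dvd_dotProduct_mulVec {S : Matrix (Fin m) (Fin m) ℤ} (hS : S.IsSymm)
    (hd : ∀ i, 2 ∣ S i i) (r : Fin m → ℤ) : 2 ∣ r ⬝ᵥ S.mulVec r := by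
  have key : ((r ⬝ᵥ S.mulVec r : ℤ) : ZMod 2) = 0 := by
    simp only [dotProduct, Matrix.mulVec, Finset.mul_sum]
    push_cast
    rw [← Finset.sum_product']
    refine Finset.sum_involution (fun p _ => p.swap) ?_ ?_ ?_ ?_
    · rintro ⟨i, j⟩ -
      simp only [Prod.swap, hS.apply i j]
      have h2 : (2 : ZMod 2) = 0 := by decide
      linear_combination (r i * (S i j * r j) : ZMod 2) * h2
    · rintro ⟨i, j⟩ - hne heq
      simp only [Prod.swap, Prod.mk.injEq] at heq
      apply hne
      obtain ⟨rfl, -⟩ := heq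
      have : ((S j j : ℤ) : ZMod 2) = 0 := (ZMod.intCast_zmod_eq_zero_iff_dvd _ 2).2 (hd j)
      simp [this]
    · simp
    · simp
  exact (ZMod.intCast_zmod_eq_zero_iff_dvd _ 2).1 key

lemma exists_Qf_latticeVec {S : Matrix (Fin m) (Fin m) ℤ} (hS : S.IsSymm)
    (hd : ∀ i, 2 ∣ S i i) (r : Fin m → ℤ) : ∃ z : ℤ, Qf S (latticeVec r) = z := by
  obtain ⟨z, hz⟩ := two_dvd_dotProduct_mulVec hS hd r
  refine ⟨z, ?_⟩
  have : bil S (latticeVec r) (latticeVec r) = ((r ⬝ᵥ S.mulVec r : ℤ) : ℚ) := by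
    simp [bil, latticeVec, dotProduct, Matrix.mulVec]
  rw [Qf, this, hz]
  push_cast
  ring

lemma eQ_add (x y : ℚ) : eQ (x + y) = eQ x * eQ y := by
  rw [eQ, eQ, eQ, ← Complex.exp_add]
  congr 1
  push_cast
  ring

lemma eQ_intCast (z : ℤ) : eQ z = 1 := by
  rw [eQ, ← Complex.exp_int_mul_two_pi_mul_I z]
  congr 1
  push_cast
  ring

lemma eQ_eq_of_sub_eq_intCast {x y : ℚ} {z : ℤ} (h : x - y = z) : eQ x = eQ y := by
  rw [← sub_add_cancel x y, eQ_add, h, eQ_intCast, one_mul]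

lemma eQ_intCast_div (N : ℕ) [NeZero N] (k : ℤ) :
    eQ (k / N) = ZMod.stdAddChar (k : ZMod N) := by
  rw [eQ, ZMod.stdAddChar_coe]
  congr 1
  push_cast
  ring

lemma eQ_intCast_div_eq_one_iff (N : ℕ) [NeZero N] (k : ℤ) : eQ (k / N) = 1 ↔ (N : ℤ) ∣ k := by
  rw [eQ_intCast_div, ← ZMod.intCast_zmod_eq_zero_iff_dvd,
    ← AddChar.map_zero_eq_one (ZMod.stdAddChar (N := N)), ZMod.injective_stdAddChar.eq_iff]

lemma sum_range_eq_sum_zmod (c : ℕ) [NeZero c] (f : ZMod c → ℂ) :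
    ∑ d ∈ range c, f d = ∑ x : ZMod c, f x := by
  refine Finset.sum_bij' (fun d _ => (d : ZMod c)) (fun x _ => x.val) ?_ ?_ ?_ ?_ ?_
  · simp
  · intro x _; simpa using x.val_lt
  · intro d hd; simpa using Nat.mod_eq_of_lt (by simpa using hd)
  · intro x _; simp
  · simp

lemma sum_range_filter_coprime_eq (N : ℕ) [NeZero N] (χ : DirichletCharacter ℂ N)
    (f : ZMod N → ℂ) :
    ∑ u ∈ (range N).filter (fun u => Nat.Coprime u N), χ (u : ZMod N) * f u =
      ∑ u : ZMod N, χ u * f u := by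
  rw [← sum_range_eq_sum_zmod N (fun u => χ u * f u)]
  refine Finset.sum_subset (Finset.filter_subset _ _) ?_
  intro u hu hu'
  have : ¬ Nat.Coprime u N := fun h => hu' (Finset.mem_filter.2 ⟨hu, h⟩)
  rw [MulChar.map_nonunit _ (by rwa [ZMod.isUnit_iff_coprime]), zero_mul]

lemma gaussS_eq_gaussSum (N : ℕ) [NeZero N] (χ : DirichletCharacter ℂ N) :
    gaussS N χ = gaussSum χ ZMod.stdAddChar := by
  rw [gaussS, gaussSum, ← sum_range_filter_coprime_eq]
  refine Finset.sum_congr rfl fun u _ => ?_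
  rw [← Int.cast_natCast (R := ℚ) u, eQ_intCast_div, Int.cast_natCast]

lemma sum_range_eQ (c : ℕ) [NeZero c] (k : ℤ) :
    ∑ d ∈ range c, eQ (d * k / c) = if (c : ℤ) ∣ k then (c : ℂ) else 0 := by
  have h := AddChar.sum_mulShift (k : ZMod c) (ZMod.isPrimitive_stdAddChar c)
  rw [← sum_range_eq_sum_zmod c (fun x => ZMod.stdAddChar (x * (k : ZMod c)))] at h
  simp only [ZMod.intCast_zmod_eq_zero_iff_dvd, ZMod.card] at h
  rw [show (if (c : ℤ) ∣ k then (c : ℂ) else 0) = ((if (c : ℤ) ∣ k then c else 0 : ℕ) : ℂ) by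
    split_ifs <;> simp, ← h]
  refine Finset.sum_congr rfl fun d _ => ?_
  rw [show (d : ZMod c) * (k : ZMod c) = ((d * k : ℤ) : ZMod c) by push_cast; rfl, ← eQ_intCast_div]
  push_cast
  rfl

lemma sum_divisors_moebius (n : ℕ) :
    ∑ e ∈ n.divisors, ArithmeticFunction.moebius e = if n = 1 then 1 else 0 := by
  rw [← ArithmeticFunction.coe_zeta_mul_apply, ArithmeticFunction.coe_zeta_mul_moebius,
    ArithmeticFunction.one_apply]

lemma sum_range_coprime (c : ℕ) (hc : 0 < c) (f : ℕ → ℂ) :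
    ∑ d ∈ (range c).filter (fun d => Nat.Coprime d c), f d =
      ∑ e ∈ c.divisors, (ArithmeticFunction.moebius e : ℂ) *
        ∑ j ∈ range (c / e), f (e * j) := by
  have h1 : ∀ d, (if Nat.Coprime d c then f d else 0) =
      ∑ e ∈ c.divisors, if e ∣ d then (ArithmeticFunction.moebius e : ℂ) * f d else 0 := by
    intro d
    rw [← Finset.sum_filter, ← Finset.sum_mul, ← Int.cast_sum,
      show c.divisors.filter (fun e => e ∣ d) = (Nat.gcd d c).divisors by
        ext e
        simp [Nat.dvd_gcd_iff, hc.ne', and_comm],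
      sum_divisors_moebius]
    by_cases h : Nat.Coprime d c
    · simp [h]
    · simp [h]
  rw [Finset.sum_filter, Finset.sum_congr rfl fun d _ => h1 d, Finset.sum_comm]
  refine Finset.sum_congr rfl fun e he => ?_
  obtain ⟨a, rfl⟩ := Nat.dvd_of_mem_divisors he
  have he0 : 0 < e := Nat.pos_of_mul_pos_right hc
  rw [Nat.mul_div_cancel_left _ he0, Finset.mul_sum, ← Finset.sum_filter]
  symm
  refine Finset.sum_bij (fun j _ => e * j) ?_ ?_ ?_ ?_
  · intro j hj
    simpa [he0] using hj
  · intro i _ j _ h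
    exact Nat.eq_of_mul_eq_mul_left he0 h
  · intro d hd
    simp only [mem_filter, mem_range] at hd
    obtain ⟨hd, j, rfl⟩ := hd
    exact ⟨j, by simpa using Nat.lt_of_mul_lt_mul_left hd, rfl⟩
  · intros; rfl

/-- Evaluation of Ramanujan sums. -/
lemma sum_coprime_eQ (c : ℕ) (hc : 0 < c) (k : ℤ) :
    ∑ d ∈ (range c).filter (fun d => Nat.Coprime d c), eQ (d * k / c) =
      ∑ a ∈ c.divisors, (ArithmeticFunction.moebius (c / a) : ℂ) *
        if (a : ℤ) ∣ k then (a : ℂ) else 0 := by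
  rw [sum_range_coprime c hc, ← Nat.sum_div_divisors c]
  refine Finset.sum_congr rfl fun a ha => ?_
  obtain ⟨e, rfl⟩ := Nat.dvd_of_mem_divisors ha
  have ha0 : 0 < a := Nat.pos_of_mul_pos_right hc
  have he0 : 0 < e := Nat.pos_of_mul_pos_left hc
  have : NeZero a := ⟨ha0.ne'⟩
  rw [Nat.mul_div_cancel_left _ ha0, Nat.mul_div_cancel _ he0, ← sum_range_eQ]
  congr 1
  refine Finset.sum_congr rfl fun j _ => ?_
  congr 1
  push_cast
  field_simp

/-- The sum of `F` over the representatives of `(ℤ/c)^m` with entries in `{0, …, c - 1}`. -/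
noncomputable def boxSum (c : ℕ) (F : (Fin m → ℤ) → ℂ) : ℂ :=
  ∑ r ∈ Fintype.piFinset (fun _ : Fin m => range c), F (fun i => (r i : ℤ))

/-- `F` is invariant under translation by `cℤ^m`. -/
def IsPeriodic (c : ℕ) (F : (Fin m → ℤ) → ℂ) : Prop :=
  ∀ r s : Fin m → ℤ, F (r + (c : ℤ) • s) = F r

lemma IsPeriodic.eq_of_cast_eq {c : ℕ} {F : (Fin m → ℤ) → ℂ} (hF : IsPeriodic c F)
    {r s : Fin m → ℤ} (h : ∀ i, (r i : ZMod c) = (s i : ZMod c)) : F r = F s := by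
  have h' : ∀ i, (c : ℤ) ∣ r i - s i := fun i => by
    rw [← ZMod.intCast_zmod_eq_zero_iff_dvd, Int.cast_sub, h i, sub_self]
  choose u hu using h'
  rw [← hF s u]
  congr 1
  ext i
  simp [← hu i]

lemma boxSum_eq_sum_fin (c : ℕ) (F : (Fin m → ℤ) → ℂ) :
    boxSum c F = ∑ v : Fin m → Fin c, F (fun i => ((v i : ℕ) : ℤ)) := by
  symm
  refine Finset.sum_bij (fun v _ i => (v i : ℕ)) ?_ ?_ ?_ ?_
  · intro v _; simp
  · intro v _ w _ h
    ext i
    exact congrFun h i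
  · intro r hr
    simp only [Fintype.mem_piFinset, mem_range] at hr
    exact ⟨fun i => ⟨r i, hr i⟩, mem_univ _, rfl⟩
  · intros; rfl

lemma boxSum_eq_sum_zmod (c : ℕ) [NeZero c] (F : (Fin m → ℤ) → ℂ) :
    boxSum c F = ∑ v : Fin m → ZMod c, F (fun i => ((v i).val : ℤ)) := by
  symm
  refine Finset.sum_bij (fun v _ i => (v i).val) ?_ ?_ ?_ ?_
  · intro v _; simpa using fun i => (v i).val_lt
  · intro v _ w _ h
    ext i
    exact ZMod.val_injective c (congrFun h i)
  · intro r hr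
    simp only [Fintype.mem_piFinset, mem_range] at hr
    refine ⟨fun i => (r i : ZMod c), mem_univ _, ?_⟩
    ext i
    exact ZMod.val_cast_of_lt (hr i)
  · intros; rfl

lemma IsPeriodic.boxSum_add {c : ℕ} [NeZero c] {F : (Fin m → ℤ) → ℂ} (hF : IsPeriodic c F)
    (s : Fin m → ℤ) : boxSum c (fun r => F (s + r)) = boxSum c F := by
  rw [boxSum_eq_sum_zmod, boxSum_eq_sum_zmod]
  refine Fintype.sum_equiv (Equiv.addLeft (fun i => (s i : ZMod c))) _ _ fun v => ?_
  apply hF.eq_of_cast_eq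
  intro i
  simp

lemma IsPeriodic.boxSum_smul {c : ℕ} [NeZero c] {F : (Fin m → ℤ) → ℂ} (hF : IsPeriodic c F)
    {d : ℕ} (hd : Nat.Coprime d c) : boxSum c (fun r => F ((d : ℤ) • r)) = boxSum c F := by
  rw [boxSum_eq_sum_zmod, boxSum_eq_sum_zmod]
  refine Fintype.sum_equiv (Equiv.piCongrRight fun _ => (ZMod.unitOfCoprime d hd).mulLeft)
    _ _ fun v => ?_
  apply hF.eq_of_cast_eq
  intro i
  simp

lemma IsPeriodic.boxSum_mul {a : ℕ} {F : (Fin m → ℤ) → ℂ} (hF : IsPeriodic a F) (e : ℕ) :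
    boxSum (e * a) F = (e : ℂ) ^ m * boxSum a F := by
  rw [boxSum_eq_sum_fin, boxSum_eq_sum_fin]
  rw [← Fintype.sum_equiv (((Equiv.arrowProdEquivProdArrow (Fin m) (fun _ => Fin e)
    (fun _ => Fin a)).symm.trans (Equiv.piCongrRight fun _ => finProdFinEquiv)))
    (fun p => F (fun i => ((p.2 i : ℕ) : ℤ))) _ fun p => ?_]
  · rw [Fintype.sum_prod_type]
    simp
  · apply hF.eq_of_cast_eq
    intro i
    simp [finProdFinEquiv]

lemma boxSum_ite_eq_repNum (S : Matrix (Fin m) (Fin m) ℤ) (γ : Fin m → ℚ) (n : ℚ) (a : ℕ)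
    (k : (Fin m → ℤ) → ℤ) (hk : ∀ r, Qf S (latticeVec r - γ) + n = k r) :
    boxSum a (fun r => if (a : ℤ) ∣ k r then 1 else 0) = (repNum S γ n a : ℂ) := by
  classical
  rw [boxSum_eq_sum_fin, repNum, Nat.card_eq_fintype_card, Fintype.card_subtype,
    Finset.sum_boole]
  congr 2
  ext v
  have := hk (fun i => ((v i : ℕ) : ℤ))
  rw [latticeVec_natCast fun i => (v i : ℕ)] at this
  simp only [mem_filter, mem_univ, true_and, this]
  refine exists_congr fun t => ?_
  norm_cast

/-- The summand of `Gsum` at the coset representative `x` with coefficients `A` and `D`. -/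
noncomputable def summand (S : Matrix (Fin m) (Fin m) ℤ) (γ : Fin m → ℚ) (c : ℕ)
    (x : Fin m → ℚ) (A : ℤ) (D : ℚ) (r : Fin m → ℤ) : ℂ :=
  eQ ((A * Qf S (x + latticeVec r) - bil S γ (x + latticeVec r) + D) / c)

section Summand

variable {S : Matrix (Fin m) (Fin m) ℤ} {γ : Fin m → ℚ}

lemma isPeriodic_summand (hS : S.IsSymm) (hd : ∀ i, 2 ∣ S i i) (hγ : memDual S γ) (c : ℕ)
    [NeZero c] {x : Fin m → ℚ} (hx : memDual S x) (A : ℤ) (D : ℚ) :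
    IsPeriodic c (summand S γ c x A D) := by
  intro r s
  obtain ⟨u, hu⟩ := exists_bil_latticeVec (memDual_add hx (memDual_latticeVec S r)) s
  obtain ⟨v, hv⟩ := exists_Qf_latticeVec hS hd s
  obtain ⟨w, hw⟩ := exists_bil_latticeVec hγ s
  have hc : (c : ℚ) ≠ 0 := NeZero.ne _
  apply eQ_eq_of_sub_eq_intCast (z := A * (u + c * v) - w)
  rw [latticeVec_add, latticeVec_smul, ← add_assoc, Qf_add hS, bil_add_right S γ (x + _),
    bil_smul_right, bil_smul_right, Qf_smul, hu, hv, hw]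
  push_cast
  field_simp
  ring

lemma boxSum_summand_eq_zero (hS : S.IsSymm) (hd : ∀ i, 2 ∣ S i i) (hγ : memDual S γ)
    {β : Fin m → ℚ} (hβ : memDual S β) (hβiso : ∃ z : ℤ, Qf S β = z) {N : ℕ}
    {w : Fin m → ℤ} (hw : latticeVec w = (N : ℚ) • β) {b : ℤ} (hb : (b : ℚ) = N * bil S γ β)
    {c p : ℕ} [NeZero c] (hpc : p ∣ c) (hpN : p ∣ N) (hpb : ¬ (p : ℤ) ∣ b) (ν A : ℤ) (D : ℚ) :
    boxSum c (summand S γ c ((ν : ℚ) • β) A D) = 0 := by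
  obtain ⟨q, hq⟩ := hβiso
  have hx : memDual S ((ν : ℚ) • β) := memDual_smul ν hβ
  have hc : c ≠ 0 := NeZero.ne _
  obtain ⟨c', rfl⟩ := hpc
  obtain ⟨N', rfl⟩ := hpN
  have hp0 : (p : ℚ) ≠ 0 := by exact_mod_cast left_ne_zero_of_mul hc
  have hc0 : (c' : ℚ) ≠ 0 := by exact_mod_cast right_ne_zero_of_mul hc
  have : NeZero p := ⟨left_ne_zero_of_mul hc⟩
  have hshift := (isPeriodic_summand hS hd hγ (p * c') hx A D).boxSum_add ((c' : ℤ) • w)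
  have hmul : ∀ r, summand S γ (p * c') ((ν : ℚ) • β) A D ((c' : ℤ) • w + r) =
      eQ ((-b : ℤ) / p) * summand S γ (p * c') ((ν : ℚ) • β) A D r := by
    intro r
    obtain ⟨z, hz⟩ := exists_bil_latticeVec hβ r
    rw [summand, summand, ← eQ_add]
    apply eQ_eq_of_sub_eq_intCast (z := A * (N' * (2 * ν * q + z) + c' * N' * (p * N') * q))
    have hββ : bil S β β = 2 * q := by rw [← hq, Qf]; ring
    rw [add_comm ((c' : ℤ) • w), latticeVec_add, latticeVec_smul, hw, ← add_assoc, Qf_add hS,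
      bil_add_right S γ (_ + _)]
    simp only [bil_smul_right, Qf_smul, bil_add_left, bil_smul_left, hββ, hq,
      bil_comm hS (latticeVec r) β, hz, ← hb]
    push_cast
    field_simp
    ring
  simp only [boxSum, hmul, ← Finset.mul_sum] at hshift
  rw [boxSum]
  by_contra h0
  have h1 := mul_right_cancel₀ h0 (hshift.trans (one_mul _).symm)
  rw [eQ_intCast_div_eq_one_iff, dvd_neg] at h1
  exact hpb h1

lemma boxSum_summand_smul (hS : S.IsSymm) (hd : ∀ i, 2 ∣ S i i) (hγ : memDual S γ)
    {β : Fin m → ℚ} (hβ : memDual S β) (hβiso : ∃ z : ℤ, Qf S β = z) {N : ℕ} [NeZero N]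
    {w : Fin m → ℤ} (hw : latticeVec w = (N : ℚ) • β) {b : ℤ} (hb : (b : ℚ) = N * bil S γ β)
    {c : ℕ} [NeZero c] {e t : ℤ} (het : c * e + N * t = 1) (ν A : ℤ) (D : ℚ) :
    boxSum c (summand S γ c ((ν : ℚ) • β) A D) =
      eQ ((ν * (-b * e) : ℤ) / N) * boxSum c (summand S γ c 0 A D) := by
  obtain ⟨q, hq⟩ := hβiso
  have hN : (N : ℚ) ≠ 0 := NeZero.ne _
  have hc : (c : ℚ) ≠ 0 := NeZero.ne _
  have h0 : memDual S (0 : Fin m → ℚ) := by simpa using memDual_smul 0 hβ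
  rw [← (isPeriodic_summand hS hd hγ c h0 A D).boxSum_add ((ν * t) • w), boxSum, boxSum,
    Finset.mul_sum]
  refine Finset.sum_congr rfl fun r' _ => ?_
  generalize (fun i => (r' i : ℤ)) = r
  set s := (ν * t) • w + r with hs
  have hsplit : (ν : ℚ) • β + latticeVec r = latticeVec s + ((c * (e * ν) : ℤ) : ℚ) • β := by
    have het' : (c * e + N * t : ℚ) = 1 := by exact_mod_cast het
    rw [hs, latticeVec_add, latticeVec_smul, hw, smul_smul, add_right_comm, ← add_smul]
    congr 2
    push_cast
    linear_combination (-ν : ℚ) * het'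
  obtain ⟨z, hz⟩ := exists_bil_latticeVec hβ s
  rw [summand, summand, ← eQ_add, hsplit, zero_add]
  apply eQ_eq_of_sub_eq_intCast (z := A * (e * ν * z + c * (e * ν) ^ 2 * q))
  rw [Qf_add hS, bil_add_right, bil_smul_right, bil_smul_right, Qf_smul, hq,
    bil_comm hS (latticeVec s) β, hz]
  push_cast
  rw [hb]
  field_simp
  ring

lemma sum_boxSum_summand_zero (hS : S.IsSymm) (hd : ∀ i, 2 ∣ S i i) (hγ : memDual S γ)
    {n : ℚ} (hn : ∃ z : ℤ, n + Qf S γ = z) (c : ℕ) [NeZero c] :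
    ∑ d ∈ (range c).filter (fun d => Nat.Coprime d c),
      boxSum c (summand S γ c 0 (adInv c d : ℤ) (d * (Qf S γ + n))) =
    (c : ℂ) ^ m * ∑ a ∈ c.divisors, (ArithmeticFunction.moebius (c / a) : ℂ) *
          (a : ℂ) ^ ((1 : ℤ) - (m : ℤ)) * (repNum S γ n a : ℂ) := by
  obtain ⟨K, hK⟩ := hn
  have hc0 : 0 < c := Nat.pos_of_neZero c
  have hc : (c : ℚ) ≠ 0 := NeZero.ne _
  have h0 : memDual S (0 : Fin m → ℚ) := by simpa using memDual_smul 0 hγ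
  have hkex : ∀ r, ∃ k : ℤ, Qf S (latticeVec r - γ) + n = k := by
    intro r
    obtain ⟨u, hu⟩ := exists_Qf_latticeVec hS hd r
    obtain ⟨v, hv⟩ := exists_bil_latticeVec hγ r
    refine ⟨u - v + K, ?_⟩
    have : latticeVec r - γ = latticeVec r + (-1 : ℚ) • γ := by
      rw [neg_one_smul, sub_eq_add_neg]
    rw [this, Qf_add hS, bil_smul_right, Qf_smul, bil_comm hS _ γ, hu, hv]
    push_cast
    linear_combination hK
  choose k hk using hkex
  have hkeq : ∀ r, (k r : ℚ) = Qf S (latticeVec r) - bil S γ (latticeVec r) + K := by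
    intro r
    have : latticeVec r - γ = latticeVec r + (-1 : ℚ) • γ := by
      rw [neg_one_smul, sub_eq_add_neg]
    rw [← hk, this, Qf_add hS, bil_smul_right, Qf_smul, bil_comm hS _ γ]
    linear_combination hK
  have hkper : ∀ a : ℕ, IsPeriodic a (fun r => if (a : ℤ) ∣ k r then (1 : ℂ) else 0) := by
    intro a r s
    obtain ⟨u, hu⟩ := exists_bil_latticeVec (memDual_latticeVec S r) s
    obtain ⟨v, hv⟩ := exists_Qf_latticeVec hS hd s
    obtain ⟨w, hw⟩ := exists_bil_latticeVec hγ s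
    have h : k (r + (a : ℤ) • s) = k r + a * (u + a * v - w) := by
      have : (k (r + (a : ℤ) • s) : ℚ) = k r + a * (u + a * v - w) := by
        rw [hkeq, hkeq, latticeVec_add, latticeVec_smul, Qf_add hS, bil_add_right,
          bil_smul_right, bil_smul_right, Qf_smul, hu, hv, hw]
        push_cast
        ring
      exact_mod_cast this
    simp only [h, dvd_add_left (dvd_mul_right (a : ℤ) _)]
  have hdil : ∀ d ∈ (range c).filter (fun d => Nat.Coprime d c),
      boxSum c (summand S γ c 0 (adInv c d : ℤ) (d * (Qf S γ + n))) =
        boxSum c (fun r => eQ (d * k r / c)) := by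
    intro d hdm
    have hdc : Nat.Coprime d c := (Finset.mem_filter.1 hdm).2
    rw [← (isPeriodic_summand hS hd hγ c h0 _ _).boxSum_smul hdc]
    congr 1
    ext r
    obtain ⟨u, hu⟩ := exists_Qf_latticeVec hS hd r
    have hinv : (c : ℤ) ∣ (adInv c d : ℤ) * d - 1 := by
      rw [← ZMod.intCast_zmod_eq_zero_iff_dvd]
      push_cast
      rw [adInv, ZMod.natCast_val, ZMod.cast_id, mul_comm, ZMod.coe_mul_inv_eq_one d hdc, sub_self]
    obtain ⟨y, hy⟩ := hinv
    have hy' : (adInv c d : ℚ) * d - 1 = c * y := by exact_mod_cast hy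
    rw [summand]
    apply eQ_eq_of_sub_eq_intCast (z := y * d * u)
    rw [hkeq, zero_add, latticeVec_smul, Qf_smul, bil_smul_right, hu, ← hK]
    push_cast
    field_simp
    linear_combination (d * u : ℚ) * hy'
  rw [Finset.sum_congr rfl hdil]
  simp only [boxSum]
  rw [Finset.sum_comm]
  simp only [sum_coprime_eQ c hc0]
  rw [Finset.sum_comm, Finset.mul_sum]
  refine Finset.sum_congr rfl fun a ha => ?_
  obtain ⟨e, he⟩ := Nat.dvd_of_mem_divisors ha
  rw [mul_comm] at he
  have ha0 : (a : ℂ) ≠ 0 := by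
    exact_mod_cast (Nat.pos_of_mem_divisors ha).ne'
  have hcount := (hkper a).boxSum_mul e
  rw [boxSum_ite_eq_repNum S γ n a k hk, ← he, boxSum] at hcount
  have hite : ∀ z : ℤ, (if (a : ℤ) ∣ z then (a : ℂ) else 0) =
      a * if (a : ℤ) ∣ z then (1 : ℂ) else 0 := by
    intro z; split_ifs <;> simp
  simp only [hite]
  rw [← Finset.mul_sum, ← Finset.mul_sum, hcount, zpow_sub₀ ha0, zpow_one, zpow_natCast]
  have hc' : (c : ℂ) = e * a := by exact_mod_cast he
  rw [hc', mul_pow]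
  field_simp

end Summand

/-- evaluation of `G_{γ,n}(c; β, χ)` for `gcd(c,g) = 1` and `χ` primitive. -/
theorem Gsum_coprime_eval (m : ℕ) (hm : 1 ≤ m) (S : Matrix (Fin m) (Fin m) ℤ)
    (hSsymm : S.IsSymm) (hSeven : ∀ i, 2 ∣ S i i) (hSdet : S.det ≠ 0)
    (γ : Fin m → ℚ) (hγ : memDual S γ) (n : ℚ) (hn : ∃ z : ℤ, n + Qf S γ = z)
    (β : Fin m → ℚ) (hβ : memDual S β) (hβiso : ∃ z : ℤ, Qf S β = z)
    (Nβ : ℕ) (hNβ : isOrderOf β Nβ)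
    (χ : DirichletCharacter ℂ Nβ) (hχ : χ.IsPrimitive)
    (b : ℤ) (hb : (b : ℚ) = Nβ * bil S γ β)
    (c : ℕ) (hc : 0 < c) (hcg : Nat.Coprime c (Int.gcd (Nβ : ℤ) b)) :
    Gsum S γ n β Nβ χ c =
      χ ((c : ℕ) : ZMod Nβ) * (starRingEnd ℂ) (χ ((-b : ℤ) : ZMod Nβ)) * gaussS Nβ χ *
        (c : ℂ) ^ m *
        ∑ a ∈ c.divisors, (ArithmeticFunction.moebius (c / a) : ℂ) *
          (a : ℂ) ^ ((1 : ℤ) - (m : ℤ)) * (repNum S γ n a : ℂ) := by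
  have : NeZero c := ⟨hc.ne'⟩
  have : NeZero Nβ := ⟨hNβ.1.ne'⟩
  choose w hw using hNβ.2.1
  have hw' : latticeVec w = (Nβ : ℚ) • β := funext fun i => (hw i).symm
  have hG : Gsum S γ n β Nβ χ c =
      ∑ ν ∈ (range Nβ).filter (fun ν => Nat.Coprime ν Nβ), χ (ν : ZMod Nβ) *
        ∑ d ∈ (range c).filter (fun d => Nat.Coprime d c),
          boxSum c (summand S γ c (((ν : ℤ) : ℚ) • β) (adInv c d : ℤ) (d * (Qf S γ + n))) := by
    simp only [Gsum, boxSum, summand, latticeVec_natCast, Int.cast_natCast,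
      Nat.cast_smul_eq_nsmul]
  rw [hG]
  by_cases hcop : Nat.Coprime c Nβ
  · obtain ⟨e, t, het⟩ : ∃ e t : ℤ, (c : ℤ) * e + Nβ * t = 1 := by
      obtain ⟨e, t, h⟩ := Nat.isCoprime_iff_coprime.2 hcop
      exact ⟨e, t, by linarith⟩
    simp only [boxSum_summand_smul hSsymm hSeven hγ hβ hβiso hw' hb het, ← Finset.mul_sum,
      sum_boxSum_summand_zero hSsymm hSeven hγ hn c, ← mul_assoc, ← Finset.sum_mul]
    congr 2
    have hsum : ∑ ν ∈ (range Nβ).filter (fun ν => Nat.Coprime ν Nβ),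
        χ (ν : ZMod Nβ) * eQ (((ν : ℤ) * -b * e : ℤ) / Nβ) =
        gaussSum χ (ZMod.stdAddChar.mulShift ((-b * e : ℤ) : ZMod Nβ)) := by
      rw [gaussSum, ← sum_range_filter_coprime_eq]
      refine Finset.sum_congr rfl fun ν _ => ?_
      rw [eQ_intCast_div, AddChar.mulShift_apply, mul_assoc, Int.cast_mul, Int.cast_natCast,
        mul_comm (ν : ZMod Nβ)]
    have hce : (c : ZMod Nβ) * (e : ZMod Nβ) = 1 := by
      have := congrArg (Int.cast : ℤ → ZMod Nβ) het
      simpa using this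
    have hχe : χ⁻¹ (e : ZMod Nβ) = χ (c : ZMod Nβ) := by
      have h1 : χ⁻¹ (c : ZMod Nβ) * χ⁻¹ (e : ZMod Nβ) = 1 := by rw [← map_mul, hce, map_one]
      have hu : IsUnit (c : ZMod Nβ) := (ZMod.isUnit_iff_coprime c Nβ).2 hcop
      have h2 : χ (c : ZMod Nβ) * χ⁻¹ (c : ZMod Nβ) = 1 := by
        rw [← MulChar.mul_apply, mul_inv_cancel, MulChar.one_apply hu]
      linear_combination χ (c : ZMod Nβ) * h1 - χ⁻¹ (e : ZMod Nβ) * h2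
    rw [hsum, gaussSum_mulShift_of_isPrimitive _ hχ, gaussS_eq_gaussSum, Int.cast_mul, map_mul,
      hχe, ← MulChar.star_apply', starRingEnd_apply]
    ring
  · obtain ⟨p, hp, hpc, hpN⟩ := Nat.Prime.not_coprime_iff_dvd.1 hcop
    have hpb : ¬ (p : ℤ) ∣ b := fun h =>
      hp.one_lt.ne' (Nat.dvd_one.1 (hcg ▸ Nat.dvd_gcd hpc
        (Int.natCast_dvd_natCast.1 (Int.dvd_coe_gcd (Int.natCast_dvd_natCast.2 hpN) h))))
    simp only [boxSum_summand_eq_zero hSsymm hSeven hγ hβ hβiso hw' hb hpc hpN hpb,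
      Finset.sum_const_zero, mul_zero]
    rw [MulChar.map_nonunit χ (by rwa [ZMod.isUnit_iff_coprime])]
    simp only [zero_mul]

end EisensteinWeil
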